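/- arXiv:1111.1538 — 2 statements merged into one kernel-verified Lean document; each statement's English description precedes it below -/
import Mathlib

section
/- Let Λ be a nonempty index set and for each λ ∈ Λ let (G_λ, d_λ) be a group equipped with a two-sided invariant metric. Let A be a group together with injective group homomorphisms φ_λ : A → G_λ such that φ_λ(A) is closed in (G_λ, d_λ) for every λ and d_{λ₁}(φ_{λ₁}(a), φ_{λ₁}(a')) = d_{λ₂}(φ_{λ₂}(a), φ_{λ₂}(a')) for all a, a' ∈ A and all λ₁, λ₂ ∈ Λ. Then there exists a two-sided invariant metric d̄ on the amalgamated free product ∐_A G_λ such that every canonical homomorphism of_λ : G_λ → ∐_A G_λ is an isometric embedding (d̄(of_λ(g), of_λ(h)) = d_λ(g, h) for all g, h ∈ G_λ), and d̄(of_{λ₁}(g₁), of_{λ₂}(g₂)) = inf_{a ∈ A} ( d_{λ₁}(g₁, φ_{λ₁}(a)) + d_{λ₂}(φ_{λ₂}(a), g₂) ) whenever λ₁ ≠ λ₂. Moreover, if Λ is countable and each (G_λ, d_λ) is separable, then (∐_A G_λ, d̄) is separable. -/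
/-- A two-sided invariant metric on a group. -/
def IsTSIMetric {G : Type*} [Group G] (d : G → G → ℝ) : Prop :=
  (∀ x y : G, d x y = 0 ↔ x = y) ∧
  (∀ x y : G, d x y = d y x) ∧
  (∀ x y z : G, d x z ≤ d x y + d y z) ∧
  (∀ g x y : G, d (g * x) (g * y) = d x y) ∧
  (∀ g x y : G, d (x * g) (y * g) = d x y)

/-- A set is closed with respect to the metric `d`. -/
def IsDClosed {G : Type*} (d : G → G → ℝ) (S : Set G) : Prop :=
  ∀ x : G, (∀ ε : ℝ, 0 < ε → ∃ s ∈ S, d x s < ε) → x ∈ S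

/-- A reduction step at cost at most `r` between words in the letters of the factors: a letter is
replaced by an element `b` of the amalgamated subgroup, at cost the distance to `b`, and absorbed
by the letter on its left; or two adjacent letters of the same factor are multiplied for free. -/
inductive GraevStep {Λ : Type*} {G : Λ → Type*} [∀ l, Group (G l)] (d : ∀ l, G l → G l → ℝ)
    {A : Type*} [Group A] (φ : ∀ l, A →* G l) : List (Σ l, G l) → List (Σ l, G l) → ℝ → Prop
  | absorb {m l : Λ} {j j' : G m} {k : G l} {S : List (Σ l, G l)} {r : ℝ} (b : A)
      (hj : j' = j * φ m b) (hr : d l k (φ l b) ≤ r) :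
      GraevStep d φ (⟨m, j⟩ :: ⟨l, k⟩ :: S) (⟨m, j'⟩ :: S) r
  | fuse {l : Λ} {g h k : G l} {S : List (Σ l, G l)} {r : ℝ} (hk : k = g * h) (hr : 0 ≤ r) :
      GraevStep d φ (⟨l, g⟩ :: ⟨l, h⟩ :: S) (⟨l, k⟩ :: S) r
  | cons (x : Σ l, G l) {S S' : List (Σ l, G l)} {r : ℝ} (h : GraevStep d φ S S' r) :
      GraevStep d φ (x :: S) (x :: S') r

/-- Elementary perturbations, at cost at most `r`, along which reductions to a single letter can be
transported: steps, changes of a letter, and transfers of an element of the amalgamated subgroup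
between adjacent letters. -/
inductive GraevPerturb {Λ : Type*} {G : Λ → Type*} [∀ l, Group (G l)] (d : ∀ l, G l → G l → ℝ)
    {A : Type*} [Group A] (φ : ∀ l, A →* G l) : List (Σ l, G l) → List (Σ l, G l) → ℝ → Prop
  | refl (S : List (Σ l, G l)) {r : ℝ} (hr : 0 ≤ r) : GraevPerturb d φ S S r
  | change {l : Λ} {k k' : G l} {S : List (Σ l, G l)} {r : ℝ} (hr : d l k k' ≤ r) :
      GraevPerturb d φ (⟨l, k⟩ :: S) (⟨l, k'⟩ :: S) r
  | slide {m l : Λ} {j j' : G m} {h h' : G l} {S : List (Σ l, G l)} {r : ℝ} (a : A)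
      (hj : j = j' * φ m a) (hr : d l (φ l a * h) h' ≤ r) :
      GraevPerturb d φ (⟨m, j⟩ :: ⟨l, h⟩ :: S) (⟨m, j'⟩ :: ⟨l, h'⟩ :: S) r
  | absorb {m l : Λ} {j j' : G m} {k : G l} {S : List (Σ l, G l)} {r : ℝ} (b : A)
      (hj : j' = j * φ m b) (hr : d l k (φ l b) ≤ r) :
      GraevPerturb d φ (⟨m, j⟩ :: ⟨l, k⟩ :: S) (⟨m, j'⟩ :: S) r
  | fuse {l : Λ} {g h k : G l} {S : List (Σ l, G l)} {r : ℝ} (hk : k = g * h) (hr : 0 ≤ r) :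
      GraevPerturb d φ (⟨l, g⟩ :: ⟨l, h⟩ :: S) (⟨l, k⟩ :: S) r
  | cons (x : Σ l, G l) {S S' : List (Σ l, G l)} {r : ℝ} (h : GraevPerturb d φ S S' r) :
      GraevPerturb d φ (x :: S) (x :: S') r

/-- `GraevCost d φ S c` says that `S` can be reduced to a single letter, and that letter moved
to `1`, at total cost at most `c`. -/
inductive GraevCost {Λ : Type*} {G : Λ → Type*} [∀ l, Group (G l)] (d : ∀ l, G l → G l → ℝ)
    {A : Type*} [Group A] (φ : ∀ l, A →* G l) : List (Σ l, G l) → ℝ → Prop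
  | single {l : Λ} {k : G l} {c : ℝ} (h : d l k 1 ≤ c) : GraevCost d φ [⟨l, k⟩] c
  | step {S S' : List (Σ l, G l)} {r c c' : ℝ} (hs : GraevStep d φ S S' r)
      (h : GraevCost d φ S' c) (hc : r + c ≤ c') : GraevCost d φ S c'

section TSI

variable {G : Type*} [Group G] {d : G → G → ℝ}

theorem IsTSIMetric.eq_iff (hd : IsTSIMetric d) {x y : G} : d x y = 0 ↔ x = y := hd.1 x y

theorem IsTSIMetric.self (hd : IsTSIMetric d) (x : G) : d x x = 0 := (hd.1 x x).2 rfl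

theorem IsTSIMetric.symm (hd : IsTSIMetric d) (x y : G) : d x y = d y x := hd.2.1 x y

theorem IsTSIMetric.triangle (hd : IsTSIMetric d) (x y z : G) : d x z ≤ d x y + d y z :=
  hd.2.2.1 x y z

theorem IsTSIMetric.mul_left (hd : IsTSIMetric d) (g x y : G) : d (g * x) (g * y) = d x y :=
  hd.2.2.2.1 g x y

theorem IsTSIMetric.mul_right (hd : IsTSIMetric d) (g x y : G) : d (x * g) (y * g) = d x y :=
  hd.2.2.2.2 g x y

theorem IsTSIMetric.nonneg (hd : IsTSIMetric d) (x y : G) : 0 ≤ d x y := by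
  have := hd.triangle x y x
  rw [hd.self, hd.symm y x] at this
  linarith

end TSI

section Graev

variable {Λ : Type*} {G : Λ → Type*} [∀ l, Group (G l)] {d : ∀ l, G l → G l → ℝ}
  {A : Type*} [Group A] {φ : ∀ l, A →* G l}

namespace GraevStep

theorem perturb {S S' : List (Σ l, G l)} {r : ℝ} (h : GraevStep d φ S S' r) :
    GraevPerturb d φ S S' r := by
  induction h with
  | absorb b hj hr => exact .absorb b hj hr
  | fuse hk hr => exact .fuse hk hr
  | cons x _ ih => exact .cons x ih

theorem append_left (U : List (Σ l, G l)) {S S' : List (Σ l, G l)} {r : ℝ}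
    (h : GraevStep d φ S S' r) : GraevStep d φ (U ++ S) (U ++ S') r := by
  induction U with
  | nil => exact h
  | cons x U ih => exact .cons x ih

theorem append_right (V : List (Σ l, G l)) {S S' : List (Σ l, G l)} {r : ℝ}
    (h : GraevStep d φ S S' r) : GraevStep d φ (S ++ V) (S' ++ V) r := by
  induction h with
  | absorb b hj hr => exact .absorb b hj hr
  | fuse hk hr => exact .fuse hk hr
  | cons x _ ih => exact .cons x ih

theorem nonneg (hd : ∀ l, IsTSIMetric (d l)) {S S' : List (Σ l, G l)} {r : ℝ}
    (h : GraevStep d φ S S' r) : 0 ≤ r := by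
  induction h with
  | absorb b hj hr => exact ((hd _).nonneg _ _).trans hr
  | fuse hk hr => exact hr
  | cons x _ ih => exact ih

/-- A step out of `S` can be completed with a perturbation of `S` to a square, at no extra cost. -/
theorem diamond (hd : ∀ l, IsTSIMetric (d l))
    (hagree : ∀ (l₁ l₂ : Λ) (a a' : A), d l₁ (φ l₁ a) (φ l₁ a') = d l₂ (φ l₂ a) (φ l₂ a'))
    {S S' T : List (Σ l, G l)} {r s : ℝ} (hs : GraevStep d φ S S' r)
    (hp : GraevPerturb d φ S T s) :
    GraevPerturb d φ S' T (r + s) ∨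
      ∃ T' r' s', GraevStep d φ T T' r' ∧ GraevPerturb d φ S' T' s' ∧ r' + s' ≤ r + s := by
  induction hs generalizing T s with
  | @absorb m l j j' k S r b hj hr =>
    subst hj
    cases hp with
    | refl _ hs => exact .inr ⟨_, _, _, .absorb b rfl hr, .refl _ hs, le_rfl⟩
    | change hs =>
      exact .inr ⟨_, _, _, .absorb b rfl hr, .change (by rwa [(hd _).mul_right]), le_rfl⟩
    | @slide _ _ _ j' _ h' _ _ a hj hs =>
      subst hj
      refine .inr ⟨_, r + s, 0, .absorb (a * b) rfl ?_, ?_, by simp⟩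
      · have h1 := (hd l).triangle h' (φ l a * k) (φ l (a * b))
        rw [map_mul, (hd l).mul_left, (hd l).symm h' (φ l a * k)] at h1
        rw [map_mul]
        linarith
      · simpa [mul_assoc] using GraevPerturb.refl _ le_rfl
    | absorb b' hj hs =>
      subst hj
      refine .inl (.change ?_)
      rw [(hd m).mul_left, hagree m l]
      have := (hd l).triangle (φ l b) k (φ l b')
      rw [(hd l).symm _ k] at this
      linarith
    | fuse hk hs =>
      subst hk
      refine .inl (.change ?_)
      rw [(hd m).mul_left, (hd m).symm]
      linarith
    | cons _ hp =>
      cases hp with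
      | refl _ hs => exact .inr ⟨_, _, _, .absorb b rfl hr, .refl _ hs, le_rfl⟩
      | @change _ _ k' _ _ hs =>
        refine .inr ⟨_, r + s, 0, .absorb b rfl ?_, .refl _ le_rfl, by simp⟩
        have := (hd l).triangle k' k (φ l b)
        rw [(hd l).symm k' k] at this
        linarith
      | slide a hk hs =>
        subst hk
        refine .inr ⟨_, r, s, .absorb (b * a⁻¹) rfl ?_, .slide a (by simp [mul_assoc]) hs, le_rfl⟩
        rw [← (hd l).mul_right (φ l a)]
        simpa using hr
      | absorb b' hk hs =>
        subst hk
        refine .inr ⟨_, r, s, .absorb (b * b') rfl ?_, .absorb b' (by simp [mul_assoc]) hs, le_rfl⟩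
        rwa [map_mul, (hd l).mul_right]
      | fuse hk hs =>
        subst hk
        refine .inl (.slide b rfl ?_)
        rw [(hd l).mul_right, (hd l).symm]
        linarith
      | cons _ hp => exact .inr ⟨_, _, _, .absorb b rfl hr, .cons _ hp, le_rfl⟩
  | @fuse l g h k S r hk hr =>
    subst hk
    cases hp with
    | refl _ hs => exact .inr ⟨_, _, _, .fuse rfl hr, .refl _ hs, le_rfl⟩
    | change hs => exact .inr ⟨_, _, _, .fuse rfl hr, .change (by rwa [(hd _).mul_right]), le_rfl⟩
    | slide a hj hs =>
      subst hj
      exact .inr ⟨_, _, _, .fuse rfl hr, .change (by rwa [mul_assoc, (hd _).mul_left]), le_rfl⟩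
    | absorb b' hj hs =>
      subst hj
      refine .inl (.change ?_)
      rw [(hd l).mul_left]
      linarith
    | fuse hk hs =>
      subst hk
      exact .inl (.refl _ (by linarith))
    | cons _ hp =>
      cases hp with
      | refl _ hs => exact .inr ⟨_, _, _, .fuse rfl hr, .refl _ hs, le_rfl⟩
      | change hs => exact .inr ⟨_, _, _, .fuse rfl hr, .change (by rwa [(hd _).mul_left]), le_rfl⟩
      | slide a hk hs =>
        exact .inr ⟨_, _, _, .fuse rfl hr, .slide a (by simp [hk, mul_assoc]) hs, le_rfl⟩
      | absorb b' hk hs =>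
        exact .inr ⟨_, _, _, .fuse rfl hr, .absorb b' (by simp [hk, mul_assoc]) hs, le_rfl⟩
      | fuse hk hs =>
        exact .inr ⟨_, _, _, .fuse rfl hr, .fuse (by simp [hk, mul_assoc]) hs, le_rfl⟩
      | cons _ hp => exact .inr ⟨_, _, _, .fuse rfl hr, .cons _ hp, le_rfl⟩
  | cons x hS ih =>
    cases hp with
    | refl _ hs => exact .inr ⟨_, _, _, .cons _ hS, .refl _ hs, le_rfl⟩
    | change hs => exact .inr ⟨_, _, _, .cons _ hS, .change hs, le_rfl⟩
    | slide a hj hs =>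
      cases hS with
      | absorb b hk hr =>
        exact .inr ⟨_, _, _, .cons _ (.absorb b rfl hr),
          .slide a hj (by rwa [hk, ← mul_assoc, (hd _).mul_right]), le_rfl⟩
      | fuse hk hr =>
        exact .inr ⟨_, _, _, .cons _ (.fuse rfl hr),
          .slide a hj (by rwa [hk, ← mul_assoc, (hd _).mul_right]), le_rfl⟩
      | cons _ hS => exact .inr ⟨_, _, _, .cons _ (.cons _ hS), .slide a hj hs, le_rfl⟩
    | @absorb _ l _ _ k _ _ b hj hs =>
      subst hj
      cases hS with
      | absorb b' hk hr =>
        refine .inr ⟨_, _, _, .absorb b' rfl hr, .absorb (b * b') (by simp [mul_assoc]) ?_, le_rfl⟩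
        rwa [hk, map_mul, (hd l).mul_right]
      | fuse hk hr =>
        refine .inl (.slide b⁻¹ (by simp [mul_assoc]) ?_)
        rw [hk, ← (hd l).mul_left (φ l b)]
        simp only [map_inv, mul_inv_cancel_left]
        rw [(hd l).mul_right]
        linarith
      | cons _ hS => exact .inr ⟨_, _, _, .cons _ hS, .absorb b rfl hs, le_rfl⟩
    | fuse hj hs =>
      subst hj
      cases hS with
      | absorb b' hk hr =>
        exact .inr ⟨_, _, _, .absorb b' rfl hr, .fuse (by simp [hk, mul_assoc]) hs, le_rfl⟩
      | fuse hk hr =>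
        exact .inr ⟨_, _, _, .fuse rfl hr, .fuse (by simp [hk, mul_assoc]) hs, le_rfl⟩
      | cons _ hS => exact .inr ⟨_, _, _, .cons _ hS, .fuse rfl hs, le_rfl⟩
    | cons _ hp =>
      rcases ih hp with h | ⟨T', r', s', h1, h2, h3⟩
      · exact .inl (.cons _ h)
      · exact .inr ⟨_, r', s', .cons _ h1, .cons _ h2, h3⟩

end GraevStep

namespace GraevCost

theorem mono {S : List (Σ l, G l)} {c c' : ℝ} (h : GraevCost d φ S c) (hc : c ≤ c') :
    GraevCost d φ S c' := by
  cases h with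
  | single h => exact .single (h.trans hc)
  | step hs h h' => exact .step hs h (h'.trans hc)

theorem nonneg (hd : ∀ l, IsTSIMetric (d l)) {S : List (Σ l, G l)} {c : ℝ}
    (h : GraevCost d φ S c) : 0 ≤ c := by
  induction h with
  | single h => exact ((hd _).nonneg _ _).trans h
  | step hs _ hc ih => linarith [hs.nonneg hd]

theorem perturb (hd : ∀ l, IsTSIMetric (d l))
    (hagree : ∀ (l₁ l₂ : Λ) (a a' : A), d l₁ (φ l₁ a) (φ l₁ a') = d l₂ (φ l₂ a) (φ l₂ a'))
    {S T : List (Σ l, G l)} {c s : ℝ} (h : GraevCost d φ S c) (hp : GraevPerturb d φ S T s) :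
    GraevCost d φ T (c + s) := by
  induction h generalizing T s with
  | @single l k c h =>
    cases hp with
    | refl _ hs => exact .single (by linarith)
    | @change _ _ k' _ _ hs =>
      refine .single ?_
      have := (hd l).triangle k' k 1
      rw [(hd l).symm k' k] at this
      linarith
    | cons _ hp =>
      cases hp with
      | refl _ hs => exact .single (by linarith)
  | step hs h hc ih =>
    rcases hs.diamond hd hagree hp with hp' | ⟨T', r', s', h1, h2, h3⟩
    · exact (ih hp').mono (by linarith)
    · exact .step h1 (ih h2) (by linarith)

/-- Free steps do not change the cost of a word. -/
theorem step_zero_iff (hd : ∀ l, IsTSIMetric (d l))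
    (hagree : ∀ (l₁ l₂ : Λ) (a a' : A), d l₁ (φ l₁ a) (φ l₁ a') = d l₂ (φ l₂ a) (φ l₂ a'))
    {S T : List (Σ l, G l)} {c : ℝ} (hs : GraevStep d φ S T 0) :
    GraevCost d φ S c ↔ GraevCost d φ T c :=
  ⟨fun h => by simpa using h.perturb hd hagree hs.perturb, fun h => .step hs h (by simp)⟩

theorem exists_cost (x : Σ l, G l) (W : List (Σ l, G l)) : ∃ c, GraevCost d φ (x :: W) c := by
  induction W generalizing x with
  | nil => exact ⟨_, .single le_rfl⟩
  | cons y W ih =>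
    obtain ⟨c, hc⟩ := ih ⟨x.1, x.2 * φ x.1 1⟩
    exact ⟨_, .step (.absorb 1 rfl le_rfl) hc le_rfl⟩

theorem insert {S U V : List (Σ l, G l)} {y : Σ l, G l} {c c' : ℝ} (h : GraevCost d φ S c)
    (h' : GraevCost d φ (U ++ y :: V) c') : GraevCost d φ (U ++ y :: (S ++ V)) (c + c') := by
  induction h with
  | @single l k c h =>
    exact .step (.append_left U (.absorb 1 (by simp) (by simpa using h))) h' le_rfl
  | step hs _ hc ih =>
    exact .step (.append_left U (.cons y (hs.append_right V))) ih (by linarith)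

end GraevCost

theorem GraevStep.absorb_base (hd : ∀ l, IsTSIMetric (d l)) (x : Σ l, G l) (l : Λ) (b : A)
    (S : List (Σ l, G l)) :
    GraevStep d φ (x :: ⟨l, φ l b⟩ :: S) (⟨x.1, x.2 * φ x.1 b⟩ :: S) 0 :=
  .absorb b rfl ((hd l).self _).le

theorem GraevStep.absorb_one (hd : ∀ l, IsTSIMetric (d l)) (x : Σ l, G l) (l : Λ)
    (S : List (Σ l, G l)) : GraevStep d φ (x :: ⟨l, 1⟩ :: S) (x :: S) 0 := by
  simpa using GraevStep.absorb_base (φ := φ) hd x l 1 S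

namespace GraevCost

theorem append (hd : ∀ l, IsTSIMetric (d l))
    (hagree : ∀ (l₁ l₂ : Λ) (a a' : A), d l₁ (φ l₁ a) (φ l₁ a') = d l₂ (φ l₂ a) (φ l₂ a'))
    {l : Λ} {W W' : List (Σ l, G l)} {c c' : ℝ} (h : GraevCost d φ (⟨l, 1⟩ :: W) c)
    (h' : GraevCost d φ (⟨l, 1⟩ :: W') c') : GraevCost d φ (⟨l, 1⟩ :: (W ++ W')) (c + c') :=
  (step_zero_iff hd hagree (.absorb_one hd ⟨l, 1⟩ l _)).1 (insert (U := []) h h')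

theorem conj (hd : ∀ l, IsTSIMetric (d l))
    (hagree : ∀ (l₁ l₂ : Λ) (a a' : A), d l₁ (φ l₁ a) (φ l₁ a') = d l₂ (φ l₂ a) (φ l₂ a'))
    {l₀ : Λ} {W : List (Σ l, G l)} {c : ℝ} (h : GraevCost d φ (⟨l₀, 1⟩ :: W) c) (y : Σ l, G l) :
    GraevCost d φ (⟨l₀, 1⟩ :: y :: (W ++ [⟨y.1, y.2⁻¹⟩])) c := by
  have h0 : GraevCost d φ ([⟨l₀, 1⟩] ++ y :: [⟨y.1, y.2⁻¹⟩]) 0 :=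
    .step (.cons _ (.fuse (k := 1) (by simp) le_rfl))
      (.step (.absorb_one hd _ _ _) (.single ((hd _).self _).le) le_rfl) (by simp)
  have := (step_zero_iff hd hagree
    (.cons ⟨l₀, 1⟩ (.absorb_one hd y l₀ _))).1 (insert h h0)
  simpa using this

end GraevCost

/-- Two words are equivalent if they can be exchanged inside any word, after a first letter,
without changing its cost. -/
def graevSetoid (d : ∀ l, G l → G l → ℝ) (φ : ∀ l, A →* G l) : Setoid (List (Σ l, G l)) where
  r W W' := ∀ U x c, GraevCost d φ (U ++ x :: W) c ↔ GraevCost d φ (U ++ x :: W') c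
  iseqv := ⟨fun _ _ _ _ => Iff.rfl, fun h U x c => (h U x c).symm,
    fun h h' U x c => (h U x c).trans (h' U x c)⟩

namespace graevSetoid

theorem cons (y : Σ l, G l) {W W' : List (Σ l, G l)} (h : graevSetoid d φ W W') :
    graevSetoid d φ (y :: W) (y :: W') := fun U x c => by
  simpa using h (U ++ [x]) y c

theorem one_cons (hd : ∀ l, IsTSIMetric (d l))
    (hagree : ∀ (l₁ l₂ : Λ) (a a' : A), d l₁ (φ l₁ a) (φ l₁ a') = d l₂ (φ l₂ a) (φ l₂ a'))
    (l : Λ) (W : List (Σ l, G l)) : graevSetoid d φ (⟨l, 1⟩ :: W) W :=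
  fun U x _ => GraevCost.step_zero_iff hd hagree (.append_left U (.absorb_one hd x l W))

theorem mul_cons (hd : ∀ l, IsTSIMetric (d l))
    (hagree : ∀ (l₁ l₂ : Λ) (a a' : A), d l₁ (φ l₁ a) (φ l₁ a') = d l₂ (φ l₂ a) (φ l₂ a'))
    (l : Λ) (g h : G l) (W : List (Σ l, G l)) :
    graevSetoid d φ (⟨l, g * h⟩ :: W) (⟨l, g⟩ :: ⟨l, h⟩ :: W) :=
  fun U x _ => (GraevCost.step_zero_iff hd hagree
    (.append_left U (.cons x (.fuse rfl le_rfl)))).symm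

theorem base_cons (hd : ∀ l, IsTSIMetric (d l))
    (hagree : ∀ (l₁ l₂ : Λ) (a a' : A), d l₁ (φ l₁ a) (φ l₁ a') = d l₂ (φ l₂ a) (φ l₂ a'))
    (l m : Λ) (a : A) (W : List (Σ l, G l)) :
    graevSetoid d φ (⟨l, φ l a⟩ :: W) (⟨m, φ m a⟩ :: W) := fun U x _ =>
  (GraevCost.step_zero_iff hd hagree (.append_left U (.absorb_base hd x l a W))).trans
    (GraevCost.step_zero_iff hd hagree (.append_left U (.absorb_base hd x m a W))).symm

end graevSetoid

/-- The action of a factor on equivalence classes of words, by adding a first letter. -/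
def graevAct (hd : ∀ l, IsTSIMetric (d l))
    (hagree : ∀ (l₁ l₂ : Λ) (a a' : A), d l₁ (φ l₁ a) (φ l₁ a') = d l₂ (φ l₂ a) (φ l₂ a'))
    (l : Λ) : G l →* Function.End (Quotient (graevSetoid d φ)) where
  toFun g := Quotient.map (fun W => ⟨l, g⟩ :: W) fun _ _ h => graevSetoid.cons _ h
  map_one' := by
    funext q
    induction q using Quotient.inductionOn with
    | h W => exact Quotient.sound (graevSetoid.one_cons hd hagree l W)
  map_mul' g h := by
    funext q
    induction q using Quotient.inductionOn with
    | h W => exact Quotient.sound (graevSetoid.mul_cons hd hagree l g h W)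

/-- The element of the amalgamated free product represented by a word. -/
def graevProd (φ : ∀ l, A →* G l) (W : List (Σ l, G l)) : Monoid.PushoutI φ :=
  (W.map fun x => Monoid.PushoutI.of x.1 x.2).prod

@[simp]
theorem graevProd_nil : graevProd φ [] = 1 := rfl

@[simp]
theorem graevProd_cons (x : Σ l, G l) (W : List (Σ l, G l)) :
    graevProd φ (x :: W) = Monoid.PushoutI.of x.1 x.2 * graevProd φ W := by
  simp [graevProd]

@[simp]
theorem graevProd_append (W W' : List (Σ l, G l)) :
    graevProd φ (W ++ W') = graevProd φ W * graevProd φ W' := by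
  simp [graevProd]

theorem exists_graevProd_eq [Nonempty Λ] (p : Monoid.PushoutI φ) : ∃ W, graevProd φ W = p := by
  induction p using Monoid.PushoutI.induction_on with
  | of l g => exact ⟨[⟨l, g⟩], by simp⟩
  | base a =>
    exact ⟨[⟨Classical.arbitrary Λ, φ _ a⟩], by simp [Monoid.PushoutI.of_apply_eq_base]⟩
  | mul p q hp hq =>
    obtain ⟨W, rfl⟩ := hp
    obtain ⟨W', rfl⟩ := hq
    exact ⟨W ++ W', by simp⟩

/-- The cost of a word depends only on the element of the amalgam that it represents. -/
theorem graevSetoid_of_graevProd_eq [Nonempty Λ] (hd : ∀ l, IsTSIMetric (d l))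
    (hagree : ∀ (l₁ l₂ : Λ) (a a' : A), d l₁ (φ l₁ a) (φ l₁ a') = d l₂ (φ l₂ a) (φ l₂ a'))
    {W W' : List (Σ l, G l)} (h : graevProd φ W = graevProd φ W') : graevSetoid d φ W W' := by
  let F := Monoid.PushoutI.lift (φ := φ) (graevAct hd hagree)
    ((graevAct hd hagree (Classical.arbitrary Λ)).comp (φ (Classical.arbitrary Λ))) fun l => by
      ext a
      funext q
      induction q using Quotient.inductionOn with
      | h W => exact Quotient.sound (graevSetoid.base_cons hd hagree _ _ a W)
  have hF (W : List (Σ l, G l)) : F (graevProd φ W) (Quotient.mk _ []) = Quotient.mk _ W := by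
    induction W with
    | nil => simp only [graevProd_nil, map_one]; rfl
    | cons x W ih =>
      rw [graevProd_cons, map_mul, Monoid.PushoutI.lift_of]
      change graevAct hd hagree x.1 x.2 (F (graevProd φ W) _) = _
      rw [ih]
      rfl
  refine Quotient.exact ?_
  rw [← hF W, ← hF W', h]

/-- `GraevBound d φ p c` says that both `p` and `p⁻¹` are represented by words of cost at
most `c`, after an initial letter `1`. -/
def GraevBound [Nonempty Λ] (d : ∀ l, G l → G l → ℝ) (φ : ∀ l, A →* G l)
    (p : Monoid.PushoutI φ) (c : ℝ) : Prop :=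
  (∃ W, graevProd φ W = p ∧ GraevCost d φ (⟨Classical.arbitrary Λ, 1⟩ :: W) c) ∧
    ∃ W, graevProd φ W = p⁻¹ ∧ GraevCost d φ (⟨Classical.arbitrary Λ, 1⟩ :: W) c

namespace GraevBound

variable [Nonempty Λ] {p q : Monoid.PushoutI φ} {c c' : ℝ}

theorem nonneg (hd : ∀ l, IsTSIMetric (d l)) (h : GraevBound d φ p c) : 0 ≤ c := by
  obtain ⟨⟨W, -, h⟩, -⟩ := h
  exact h.nonneg hd

theorem exists_bound (p : Monoid.PushoutI φ) : ∃ c, GraevBound d φ p c := by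
  obtain ⟨W, hW⟩ := exists_graevProd_eq p
  obtain ⟨W', hW'⟩ := exists_graevProd_eq p⁻¹
  obtain ⟨c, hc⟩ := GraevCost.exists_cost (d := d) (φ := φ) ⟨Classical.arbitrary Λ, 1⟩ W
  obtain ⟨c', hc'⟩ := GraevCost.exists_cost (d := d) (φ := φ) ⟨Classical.arbitrary Λ, 1⟩ W'
  exact ⟨max c c', ⟨W, hW, hc.mono (le_max_left _ _)⟩, W', hW', hc'.mono (le_max_right _ _)⟩

theorem one (hd : ∀ l, IsTSIMetric (d l)) : GraevBound d φ 1 0 :=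
  have h : GraevCost d φ [⟨Classical.arbitrary Λ, 1⟩] 0 := .single ((hd _).self _).le
  ⟨⟨[], rfl, h⟩, [], by simp, h⟩

theorem inv (h : GraevBound d φ p c) : GraevBound d φ p⁻¹ c :=
  ⟨h.2, by simpa using h.1⟩

theorem mul (hd : ∀ l, IsTSIMetric (d l))
    (hagree : ∀ (l₁ l₂ : Λ) (a a' : A), d l₁ (φ l₁ a) (φ l₁ a') = d l₂ (φ l₂ a) (φ l₂ a'))
    (h : GraevBound d φ p c) (h' : GraevBound d φ q c') : GraevBound d φ (p * q) (c + c') := by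
  obtain ⟨⟨W₁, rfl, h₁⟩, W₂, e₂, h₂⟩ := h
  obtain ⟨⟨W₃, rfl, h₃⟩, W₄, e₄, h₄⟩ := h'
  exact ⟨⟨W₁ ++ W₃, by simp, h₁.append hd hagree h₃⟩,
    W₄ ++ W₂, by simp [e₂, e₄], add_comm c c' ▸ h₄.append hd hagree h₂⟩

theorem conj_of (hd : ∀ l, IsTSIMetric (d l))
    (hagree : ∀ (l₁ l₂ : Λ) (a a' : A), d l₁ (φ l₁ a) (φ l₁ a') = d l₂ (φ l₂ a) (φ l₂ a'))
    (h : GraevBound d φ p c) (l : Λ) (g : G l) :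
    GraevBound d φ (.of l g * p * (.of l g)⁻¹) c := by
  obtain ⟨⟨W₁, rfl, h₁⟩, W₂, e₂, h₂⟩ := h
  exact ⟨⟨_, by simp [mul_assoc], h₁.conj hd hagree ⟨l, g⟩⟩,
    _, by simp [e₂, mul_assoc], h₂.conj hd hagree ⟨l, g⟩⟩

theorem conj (hd : ∀ l, IsTSIMetric (d l))
    (hagree : ∀ (l₁ l₂ : Λ) (a a' : A), d l₁ (φ l₁ a) (φ l₁ a') = d l₂ (φ l₂ a) (φ l₂ a'))
    (h : GraevBound d φ p c) (q : Monoid.PushoutI φ) : GraevBound d φ (q * p * q⁻¹) c := by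
  induction q using Monoid.PushoutI.induction_on generalizing p with
  | of l g => exact h.conj_of hd hagree l g
  | base a =>
    rw [← Monoid.PushoutI.of_apply_eq_base φ (Classical.arbitrary Λ)]
    exact h.conj_of hd hagree _ _
  | mul x y hx hy => simpa [mul_assoc] using hx (hy h)

theorem cost (hd : ∀ l, IsTSIMetric (d l))
    (hagree : ∀ (l₁ l₂ : Λ) (a a' : A), d l₁ (φ l₁ a) (φ l₁ a') = d l₂ (φ l₂ a) (φ l₂ a'))
    (h : GraevBound d φ p c) {W : List (Σ l, G l)} (hW : graevProd φ W = p) :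
    GraevCost d φ (⟨Classical.arbitrary Λ, 1⟩ :: W) c := by
  obtain ⟨⟨W', h', hc⟩, -⟩ := h
  exact (graevSetoid_of_graevProd_eq hd hagree (hW.trans h'.symm) [] _ c).2 hc

theorem of (hd : ∀ l, IsTSIMetric (d l)) (l : Λ) (g : G l) :
    GraevBound d φ (.of l g) (d l g 1) := by
  have key (g : G l) : GraevCost d φ [⟨Classical.arbitrary Λ, 1⟩, ⟨l, g⟩] (d l g 1) :=
    .step (r := d l g 1) (c := 0) (.absorb (j' := 1) 1 (by simp) (by simp))
      (.single ((hd _).self _).le) (by simp)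
  have h : d l g⁻¹ 1 = d l g 1 := by
    rw [← (hd l).mul_left g, mul_inv_cancel, mul_one, (hd l).symm]
  exact ⟨⟨_, by simp, key g⟩, _, by simp, h ▸ key g⁻¹⟩

end GraevBound

theorem GraevCost.le_of_singleton {l : Λ} {k : G l} {c : ℝ} (h : GraevCost d φ [⟨l, k⟩] c) :
    d l k 1 ≤ c := by
  cases h with
  | single h => exact h
  | step hs => cases hs with
    | cons _ hs => cases hs

theorem GraevCost.le_of_base_cons (hd : ∀ l, IsTSIMetric (d l))
    (hagree : ∀ (l₁ l₂ : Λ) (a a' : A), d l₁ (φ l₁ a) (φ l₁ a') = d l₂ (φ l₂ a) (φ l₂ a'))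
    {m l : Λ} {a : A} {g : G l} {c : ℝ} (h : GraevCost d φ [⟨m, φ m a⟩, ⟨l, g⟩] c) :
    d l (φ l a * g) 1 ≤ c := by
  cases h with
  | step hs h hc =>
    cases hs with
    | absorb b hj hr =>
      have h1 := h.le_of_singleton
      have h2 := (hd l).triangle (φ l a * g) (φ l a * φ l b) 1
      rw [(hd l).mul_left] at h2
      rw [hj] at h1
      have h3 := hagree m l (a * b) 1
      simp only [map_mul, map_one] at h3
      linarith
    | fuse hk hr =>
      have := h.le_of_singleton
      rw [hk] at this
      linarith
    | cons _ hs => cases hs with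
      | cons _ hs => cases hs

theorem GraevCost.le_of_one_cons (hd : ∀ l, IsTSIMetric (d l))
    (hagree : ∀ (l₁ l₂ : Λ) (a a' : A), d l₁ (φ l₁ a) (φ l₁ a') = d l₂ (φ l₂ a) (φ l₂ a'))
    {m l : Λ} {g : G l} {c : ℝ} (h : GraevCost d φ [⟨m, 1⟩, ⟨l, g⟩] c) : d l g 1 ≤ c := by
  simpa using GraevCost.le_of_base_cons hd hagree (a := 1) (by simpa using h)

theorem GraevCost.exists_le (hd : ∀ l, IsTSIMetric (d l))
    (hagree : ∀ (l₁ l₂ : Λ) (a a' : A), d l₁ (φ l₁ a) (φ l₁ a') = d l₂ (φ l₂ a) (φ l₂ a'))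
    {l₀ l₁ l₂ : Λ} (hne : l₁ ≠ l₂) {g₁ : G l₁} {g₂ : G l₂} {c : ℝ}
    (h : GraevCost d φ [⟨l₀, 1⟩, ⟨l₁, g₁⁻¹⟩, ⟨l₂, g₂⟩] c) :
    ∃ a, d l₁ g₁ (φ l₁ a) + d l₂ (φ l₂ a) g₂ ≤ c := by
  have hinv (l : Λ) (x y : G l) : d l x⁻¹ y⁻¹ = d l x y := by
    rw [← (hd l).mul_left x, ← (hd l).mul_right y, (hd l).symm]
    simp
  have left (b : A) {r c' : ℝ} (hr : d l₁ g₁⁻¹ (φ l₁ b) ≤ r)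
      (h : d l₂ (φ l₂ b * g₂) 1 ≤ c') (hc : r + c' ≤ c) :
      ∃ a, d l₁ g₁ (φ l₁ a) + d l₂ (φ l₂ a) g₂ ≤ c := by
    refine ⟨b⁻¹, ?_⟩
    rw [← hinv l₁, ← (hd l₂).mul_left (φ l₂ b), (hd l₂).symm (φ l₂ b * _)]
    simp only [map_inv, inv_inv, mul_inv_cancel]
    linarith
  have right (b : A) {r c' : ℝ} (hr : d l₂ g₂ (φ l₂ b) ≤ r)
      (h : d l₁ (g₁⁻¹ * φ l₁ b) 1 ≤ c') (hc : r + c' ≤ c) :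
      ∃ a, d l₁ g₁ (φ l₁ a) + d l₂ (φ l₂ a) g₂ ≤ c := by
    refine ⟨b, ?_⟩
    rw [← (hd l₁).mul_left g₁⁻¹, (hd l₂).symm, (hd l₁).symm]
    simp only [inv_mul_cancel]
    linarith
  cases h with
  | step hs h hc =>
    cases hs with
    | absorb b hj hr =>
      rw [one_mul] at hj
      subst hj
      exact left b hr (h.le_of_base_cons hd hagree) hc
    | fuse hk hr =>
      rw [one_mul] at hk
      subst hk
      cases h with
      | step hs h hc' =>
        cases hs with
        | absorb b hj hr =>
          subst hj
          exact right b hr h.le_of_singleton (by linarith)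
        | fuse => exact absurd rfl hne
        | cons _ hs => cases hs with
          | cons _ hs => cases hs
    | cons _ hs =>
      cases hs with
      | absorb b hj hr =>
        subst hj
        exact right b hr (h.le_of_one_cons hd hagree) hc
      | fuse => exact absurd rfl hne
      | cons _ hs => cases hs with
        | cons _ hs => cases hs

theorem GraevStep.le_of_far {S S' : List (Σ l, G l)} {r δ : ℝ} (hs : GraevStep d φ S S' r)
    (hchain : S.IsChain fun x y => x.1 ≠ y.1) (hfar : ∀ x ∈ S, ∀ a, δ ≤ d x.1 x.2 (φ x.1 a)) :
    δ ≤ r := by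
  induction hs with
  | absorb b _ hr => exact (hfar ⟨_, _⟩ (by simp) b).trans hr
  | fuse => simp at hchain
  | cons x _ ih =>
    exact ih hchain.tail fun y hy => hfar y (.tail x hy)

theorem GraevCost.le_of_far (hd : ∀ l, IsTSIMetric (d l)) {S : List (Σ l, G l)} {c δ : ℝ}
    (h : GraevCost d φ S c) (hchain : S.IsChain fun x y => x.1 ≠ y.1)
    (hfar : ∀ x ∈ S, ∀ a, δ ≤ d x.1 x.2 (φ x.1 a)) : δ ≤ c := by
  cases h with
  | @single l k _ h => simpa using (hfar ⟨l, k⟩ (by simp) 1).trans (by simpa using h)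
  | step hs h hc =>
    linarith [hs.le_of_far hchain hfar, h.nonneg hd]

theorem GraevCost.le_of_far_cons (hd : ∀ l, IsTSIMetric (d l)) {S : List (Σ l, G l)} {l : Λ}
    {c δ : ℝ} (h : GraevCost d φ (⟨l, 1⟩ :: S) c) (hS : S ≠ [])
    (hchain : S.IsChain fun x y => x.1 ≠ y.1)
    (hfar : ∀ x ∈ S, ∀ a, δ ≤ d x.1 x.2 (φ x.1 a)) : δ ≤ c := by
  cases h with
  | single h => exact absurd rfl hS
  | step hs h hc =>
    cases hs with
    | absorb b _ hr => linarith [hfar _ List.mem_cons_self b, h.nonneg hd]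
    | fuse hk hr =>
      rw [one_mul] at hk
      subst hk
      linarith [h.le_of_far hd hchain hfar]
    | cons _ hs =>
      linarith [hs.le_of_far hchain hfar, h.nonneg hd]

/-- A word is reduced if adjacent letters come from different factors and no letter lies in the
amalgamated subgroup. -/
def GraevReduced (φ : ∀ l, A →* G l) (W : List (Σ l, G l)) : Prop :=
  W.IsChain (fun x y => x.1 ≠ y.1) ∧ ∀ x ∈ W, x.2 ∉ Set.range (φ x.1)

namespace GraevReduced

theorem head {l : Λ} {g h : G l} {W : List (Σ l, G l)} (hW : GraevReduced φ (⟨l, g⟩ :: W))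
    (hh : h ∉ Set.range (φ l)) : GraevReduced φ (⟨l, h⟩ :: W) := by
  refine ⟨?_, List.forall_mem_cons.2 ⟨hh, fun x hx => hW.2 x (.tail _ hx)⟩⟩
  have := hW.1
  rw [List.isChain_cons] at this ⊢
  exact this

theorem base_mul {l : Λ} {g : G l} {W : List (Σ l, G l)} (hW : GraevReduced φ (⟨l, g⟩ :: W))
    (a : A) : GraevReduced φ (⟨l, φ l a * g⟩ :: W) := by
  refine hW.head ?_
  rintro ⟨b, hb⟩
  exact hW.2 ⟨l, g⟩ List.mem_cons_self ⟨a⁻¹ * b, by simp [hb]⟩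

theorem tail {x : Σ l, G l} {W : List (Σ l, G l)} (hW : GraevReduced φ (x :: W)) :
    GraevReduced φ W :=
  ⟨hW.1.tail, fun y hy => hW.2 y (.tail _ hy)⟩

theorem exists_of_mul (l : Λ) (g : G l) {p : Monoid.PushoutI φ}
    (hp : (∃ a, Monoid.PushoutI.base φ a = p) ∨
      ∃ W ≠ [], GraevReduced φ W ∧ graevProd φ W = p) :
    (∃ a, Monoid.PushoutI.base φ a = .of l g * p) ∨
      ∃ W ≠ [], GraevReduced φ W ∧ graevProd φ W = .of l g * p := by
  have absorb (a : A) {W : List (Σ l, G l)} (hW : GraevReduced φ W) (hne : W ≠ []) :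
      ∃ W' ≠ [], GraevReduced φ W' ∧
        graevProd φ W' = Monoid.PushoutI.base φ a * graevProd φ W := by
    cases W with
    | nil => exact absurd rfl hne
    | cons x W =>
      exact ⟨_, List.cons_ne_nil _ _, hW.base_mul a,
        by simp [mul_assoc, Monoid.PushoutI.of_apply_eq_base]⟩
  rcases hp with ⟨a, rfl⟩ | ⟨W, hne, hW, rfl⟩
  · rw [← Monoid.PushoutI.of_apply_eq_base φ l, ← map_mul]
    by_cases h : g * φ l a ∈ Set.range (φ l)
    · obtain ⟨b, hb⟩ := h
      exact .inl ⟨b, by rw [← hb, Monoid.PushoutI.of_apply_eq_base]⟩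
    · exact .inr ⟨[⟨l, g * φ l a⟩], by simp, ⟨by simp, by simpa using h⟩, by simp⟩
  by_cases hg : g ∈ Set.range (φ l)
  · obtain ⟨a, rfl⟩ := hg
    rw [Monoid.PushoutI.of_apply_eq_base]
    exact .inr (absorb a hW hne)
  cases W with
  | nil => exact absurd rfl hne
  | cons x W =>
    obtain ⟨m, h⟩ := x
    by_cases hlm : l = m
    · subst hlm
      rw [graevProd_cons, ← mul_assoc, ← map_mul]
      by_cases hgh : g * h ∈ Set.range (φ l)
      · obtain ⟨a, ha⟩ := hgh
        rw [← ha, Monoid.PushoutI.of_apply_eq_base]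
        by_cases hW' : W = []
        · subst hW'
          exact .inl ⟨a, by simp⟩
        · exact .inr (absorb a hW.tail hW')
      · exact .inr ⟨_, List.cons_ne_nil _ _, hW.head hgh, by simp⟩
    · exact .inr ⟨⟨l, g⟩ :: ⟨m, h⟩ :: W, List.cons_ne_nil _ _,
        ⟨.cons_cons hlm hW.1, List.forall_mem_cons.2 ⟨hg, hW.2⟩⟩, by simp⟩

theorem exists_graevProd_eq [Nonempty Λ] (p : Monoid.PushoutI φ) :
    (∃ a, Monoid.PushoutI.base φ a = p) ∨ ∃ W ≠ [], GraevReduced φ W ∧ graevProd φ W = p := by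
  obtain ⟨W, rfl⟩ := _root_.exists_graevProd_eq p
  induction W with
  | nil => exact .inl ⟨1, by simp⟩
  | cons x W ih =>
    rw [graevProd_cons]
    exact exists_of_mul x.1 x.2 ih

/-- By closedness of the amalgamated subgroup, the letters of a reduced word are uniformly far
from it. -/
theorem exists_far (hclosed : ∀ l, IsDClosed (d l) (Set.range (φ l))) {W : List (Σ l, G l)}
    (hW : GraevReduced φ W) : ∃ δ > 0, ∀ x ∈ W, ∀ a, δ ≤ d x.1 x.2 (φ x.1 a) := by
  induction W with
  | nil => exact ⟨1, one_pos, by simp⟩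
  | cons x W ih =>
    obtain ⟨δ, hδ, h⟩ := ih hW.tail
    have hx := mt (hclosed x.1 x.2) (hW.2 x List.mem_cons_self)
    push Not at hx
    obtain ⟨ε, hε, hx⟩ := hx
    refine ⟨min δ ε, lt_min hδ hε, List.forall_mem_cons.2 ⟨fun a => ?_, fun y hy a => ?_⟩⟩
    · exact (min_le_right _ _).trans (hx _ ⟨a, rfl⟩)
    · exact (min_le_left _ _).trans (h y hy a)

end GraevReduced

theorem GraevBound.exists_pos_le [Nonempty Λ] (hd : ∀ l, IsTSIMetric (d l))
    (hclosed : ∀ l, IsDClosed (d l) (Set.range (φ l)))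
    (hagree : ∀ (l₁ l₂ : Λ) (a a' : A), d l₁ (φ l₁ a) (φ l₁ a') = d l₂ (φ l₂ a) (φ l₂ a'))
    {p : Monoid.PushoutI φ} (hp : p ≠ 1) : ∃ δ > 0, ∀ c, GraevBound d φ p c → δ ≤ c := by
  rcases GraevReduced.exists_graevProd_eq p with ⟨a, rfl⟩ | ⟨W, hne, hW, rfl⟩
  · let l := Classical.arbitrary Λ
    rw [← Monoid.PushoutI.of_apply_eq_base φ l] at hp ⊢
    refine ⟨d l (φ l a) 1, ((hd l).nonneg _ _).lt_of_ne' fun h => hp ?_, fun c hc => ?_⟩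
    · rw [(hd l).eq_iff.1 h, map_one]
    · exact (hc.cost hd hagree (W := [⟨l, φ l a⟩]) (by simp)).le_of_one_cons hd hagree
  · obtain ⟨δ, hδ, h⟩ := hW.exists_far hclosed
    exact ⟨δ, hδ, fun c hc => (hc.cost hd hagree rfl).le_of_far_cons hd hne hW.1 h⟩

/-- A family of upper bounds on a group that is subadditive, symmetric, conjugation invariant and
bounded away from zero off the identity induces a two-sided invariant metric. -/
theorem exists_isTSIMetric_of_bound {P : Type*} [Group P] (Q : P → ℝ → Prop)
    (hnonneg : ∀ p c, Q p c → 0 ≤ c) (hex : ∀ p, ∃ c, Q p c) (hone : Q 1 0)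
    (hinv : ∀ p c, Q p c → Q p⁻¹ c) (hmul : ∀ p q c c', Q p c → Q q c' → Q (p * q) (c + c'))
    (hconj : ∀ p q c, Q p c → Q (q * p * q⁻¹) c)
    (hpos : ∀ p, p ≠ 1 → ∃ δ > 0, ∀ c, Q p c → δ ≤ c) :
    ∃ D : P → P → ℝ, IsTSIMetric D ∧ (∀ x y c, Q (x⁻¹ * y) c → D x y ≤ c) ∧
      ∀ x y e, (∀ c, Q (x⁻¹ * y) c → e ≤ c) → e ≤ D x y := by
  have hbdd (p : P) : BddBelow {c | Q p c} := ⟨0, fun c => hnonneg p c⟩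
  have hle (x y : P) (e : ℝ) (h : ∀ c, Q (x⁻¹ * y) c → e ≤ c) :
      e ≤ sInf {c | Q (x⁻¹ * y) c} := le_csInf (hex _) h
  have hge (x y : P) (c : ℝ) (h : Q (x⁻¹ * y) c) : sInf {c | Q (x⁻¹ * y) c} ≤ c :=
    csInf_le (hbdd _) h
  refine ⟨fun x y => sInf {c | Q (x⁻¹ * y) c}, ⟨fun x y => ⟨fun h => ?_, ?_⟩, fun x y => ?_,
    fun x y z => ?_, fun g x y => ?_, fun g x y => ?_⟩, hge, hle⟩
  · by_contra hxy
    obtain ⟨δ, hδ, h'⟩ := hpos (x⁻¹ * y) (by rwa [ne_eq, inv_mul_eq_one])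
    exact absurd (hle x y δ h') (by simpa [h] using hδ)
  · rintro rfl
    exact le_antisymm (hge x x 0 (by simpa using hone)) (hle x x 0 (hnonneg _))
  · exact le_antisymm (hle y x _ fun c hc => hge x y c (by simpa using hinv _ _ hc))
      (hle x y _ fun c hc => hge y x c (by simpa using hinv _ _ hc))
  · rw [← sub_le_iff_le_add]
    refine hle x y _ fun c hc => ?_
    rw [sub_le_comm]
    refine hle y z _ fun c' hc' => ?_
    rw [sub_le_iff_le_add']
    exact hge x z _ (by simpa [mul_assoc] using hmul _ _ _ _ hc hc')
  · simp [mul_assoc]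
  · refine le_antisymm (hle x y _ fun c hc => hge _ _ c ?_)
      (hle (x * g) (y * g) _ fun c hc => hge _ _ c ?_)
    · simpa [mul_assoc] using hconj _ g⁻¹ _ hc
    · simpa [mul_assoc] using hconj _ g _ hc

/-- Products of letters from countable dense subsets are dense in the amalgam. -/
theorem exists_countable_dense_amalgam [Nonempty Λ] [Countable Λ]
    {D : Monoid.PushoutI φ → Monoid.PushoutI φ → ℝ} (hD : IsTSIMetric D)
    (hof : ∀ (l : Λ) (g h : G l), D (.of l g) (.of l h) = d l g h)
    (hsep : ∀ l, ∃ s : Set (G l), s.Countable ∧ ∀ x, ∀ ε : ℝ, 0 < ε → ∃ y ∈ s, d l x y < ε) :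
    ∃ s : Set (Monoid.PushoutI φ), s.Countable ∧
      ∀ x, ∀ ε : ℝ, 0 < ε → ∃ y ∈ s, D x y < ε := by
  choose s hs hdense using hsep
  have hletters : {x : Σ l, G l | x.2 ∈ s x.1}.Countable := by
    refine (Set.countable_iUnion fun l => (hs l).image (Sigma.mk l)).mono fun x hx => ?_
    exact Set.mem_iUnion.2 ⟨x.1, x.2, hx, rfl⟩
  have := hletters.to_subtype
  refine ⟨Set.range fun W : List {x : Σ l, G l | x.2 ∈ s x.1} =>
    graevProd φ (W.map Subtype.val), Set.countable_range _, fun x => ?_⟩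
  have hfactor (l : Λ) (g : G l) (ε : ℝ) (hε : 0 < ε) :
      ∃ y ∈ Set.range fun W : List {x : Σ l, G l | x.2 ∈ s x.1} =>
        graevProd φ (W.map Subtype.val), D (.of l g) y < ε := by
    obtain ⟨y, hy, h⟩ := hdense l g ε hε
    exact ⟨_, ⟨[⟨⟨l, y⟩, hy⟩], rfl⟩, by simpa [hof] using h⟩
  induction x using Monoid.PushoutI.induction_on with
  | of l g => exact hfactor l g
  | base a =>
    rw [← Monoid.PushoutI.of_apply_eq_base φ (Classical.arbitrary Λ)]
    exact hfactor _ _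
  | mul x y hx hy =>
    intro ε hε
    obtain ⟨_, ⟨W, rfl⟩, hW⟩ := hx (ε / 2) (half_pos hε)
    obtain ⟨_, ⟨W', rfl⟩, hW'⟩ := hy (ε / 2) (half_pos hε)
    refine ⟨_, ⟨W ++ W', rfl⟩, ?_⟩
    simp only [List.map_append, graevProd_append]
    have := hD.triangle (x * y) (graevProd φ (W.map Subtype.val) * y)
      (graevProd φ (W.map Subtype.val) * graevProd φ (W'.map Subtype.val))
    rw [hD.mul_left, hD.mul_right] at this
    linarith

end Graev

/-- **Graev metrics on amalgamated free products.**  Given groups `(G λ, d λ)` with two-sided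
invariant metrics, a common closed subgroup `A` (given via injective homomorphisms `φ λ` with
closed images on which all the metrics agree), there is a two-sided invariant metric on the
amalgamated free product `∐_A G λ` making every canonical map `of λ` an isometric embedding and
realizing the amalgam distance between elements of distinct factors; moreover the amalgam is
separable whenever the index set is countable and each factor is separable. -/
theorem graev_metric_on_amalgam {Λ : Type*} [Nonempty Λ] {G : Λ → Type*} [∀ l, Group (G l)]
    (d : ∀ l, G l → G l → ℝ) (hd : ∀ l, IsTSIMetric (d l))
    {A : Type*} [Group A] (φ : ∀ l, A →* G l)
    (hinj : ∀ l, Function.Injective (φ l))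
    (hclosed : ∀ l, IsDClosed (d l) (Set.range (φ l)))
    (hagree : ∀ (l₁ l₂ : Λ) (a a' : A), d l₁ (φ l₁ a) (φ l₁ a') = d l₂ (φ l₂ a) (φ l₂ a')) :
    ∃ dbar : Monoid.PushoutI φ → Monoid.PushoutI φ → ℝ,
      IsTSIMetric dbar ∧
      (∀ (l : Λ) (g h : G l),
        dbar (Monoid.PushoutI.of (φ := φ) l g) (Monoid.PushoutI.of (φ := φ) l h) = d l g h) ∧
      (∀ (l₁ l₂ : Λ), l₁ ≠ l₂ → ∀ (g₁ : G l₁) (g₂ : G l₂),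
        dbar (Monoid.PushoutI.of (φ := φ) l₁ g₁) (Monoid.PushoutI.of (φ := φ) l₂ g₂)
          = ⨅ a : A, (d l₁ g₁ (φ l₁ a) + d l₂ (φ l₂ a) g₂)) ∧
      ((Countable Λ ∧ ∀ l, ∃ D : Set (G l), D.Countable ∧
          ∀ x : G l, ∀ ε : ℝ, 0 < ε → ∃ y ∈ D, d l x y < ε) →
        ∃ D : Set (Monoid.PushoutI φ), D.Countable ∧
          ∀ x : Monoid.PushoutI φ, ∀ ε : ℝ, 0 < ε → ∃ y ∈ D, dbar x y < ε) := by
  have hinv (l : Λ) (g h : G l) : d l (g⁻¹ * h) 1 = d l g h := by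
    rw [← (hd l).mul_left g, mul_inv_cancel_left, mul_one, (hd l).symm]
  obtain ⟨D, hD, hle, hge⟩ := exists_isTSIMetric_of_bound (GraevBound d φ)
    (fun _ _ h => h.nonneg hd) GraevBound.exists_bound (GraevBound.one hd) (fun _ _ h => h.inv)
    (fun _ _ _ _ h h' => h.mul hd hagree h') (fun _ q _ h => h.conj hd hagree q)
    (fun _ hp => GraevBound.exists_pos_le hd hclosed hagree hp)
  have hof (l : Λ) (g h : G l) :
      D (Monoid.PushoutI.of (φ := φ) l g) (Monoid.PushoutI.of (φ := φ) l h) = d l g h := by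
    rw [← hinv]
    refine le_antisymm (hle _ _ _ ?_) (hge _ _ _ fun c hc => ?_)
    · rw [← map_inv, ← map_mul]
      exact .of hd l _
    · exact (hc.cost hd hagree (W := [⟨l, g⁻¹ * h⟩]) (by simp)).le_of_one_cons hd hagree
  refine ⟨D, hD, hof, fun l₁ l₂ hne g₁ g₂ => ?_, fun ⟨_, hsep⟩ =>
    exists_countable_dense_amalgam hD hof hsep⟩
  have hbdd : BddBelow (Set.range fun a : A => d l₁ g₁ (φ l₁ a) + d l₂ (φ l₂ a) g₂) := by
    refine ⟨0, ?_⟩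
    rintro _ ⟨a, rfl⟩
    exact add_nonneg ((hd _).nonneg _ _) ((hd _).nonneg _ _)
  refine le_antisymm (le_ciInf fun a => ?_) (hge _ _ _ fun c hc => ?_)
  · have := hD.triangle (.of l₁ g₁) (.of l₁ (φ l₁ a)) (.of l₂ g₂)
    rw [hof, Monoid.PushoutI.of_apply_eq_base, ← Monoid.PushoutI.of_apply_eq_base φ l₂, hof] at this
    exact this
  · obtain ⟨a, ha⟩ := (hc.cost hd hagree (W := [⟨l₁, g₁⁻¹⟩, ⟨l₂, g₂⟩])
      (by simp)).exists_le hd hagree hne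
    exact (ciInf_le hbdd a).trans ha
end

section
/- Assume the amalgam setting: groups (G_λ, d_λ) with two-sided invariant metrics, a group A with injective homomorphisms φ_λ : A → G_λ having closed images and with d_{λ₁}(φ_{λ₁}(a), φ_{λ₁}(a')) = d_{λ₂}(φ_{λ₂}(a), φ_{λ₂}(a')) for all a, a' ∈ A, λ₁, λ₂. Let d̄ be the Graev metric on ∐_A G_λ. Let (T, d_T) be a group with a two-sided invariant metric, K > 0, and let ψ_λ : G_λ → T be group homomorphisms that are K-Lipschitz (d_T(ψ_λ(g), ψ_λ(h)) ≤ K·d_λ(g, h)) and satisfy ψ_{λ₁} ∘ φ_{λ₁} = ψ_{λ₂} ∘ φ_{λ₂} for all λ₁, λ₂. Then the unique homomorphism ψ : ∐_A G_λ → T with ψ ∘ of_λ = ψ_λ for all λ is K-Lipschitz from (∐_A G_λ, d̄) to (T, d_T). -/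
/-- A metric on the amalgamated free product extends the amalgam metric: it restricts to `d λ`
on each factor and realizes the amalgam distance between elements of distinct factors. -/
def ExtendsAmalgamMetric {Λ : Type*} {G : Λ → Type*} [∀ l, Group (G l)]
    {A : Type*} [Group A] (φ : ∀ l, A →* G l) (d : ∀ l, G l → G l → ℝ)
    (dbar : Monoid.PushoutI φ → Monoid.PushoutI φ → ℝ) : Prop :=
  (∀ (l : Λ) (g h : G l),
    dbar (Monoid.PushoutI.of (φ := φ) l g) (Monoid.PushoutI.of (φ := φ) l h) = d l g h) ∧
  (∀ (l₁ l₂ : Λ), l₁ ≠ l₂ → ∀ (g₁ : G l₁) (g₂ : G l₂),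
    dbar (Monoid.PushoutI.of (φ := φ) l₁ g₁) (Monoid.PushoutI.of (φ := φ) l₂ g₂)
      = ⨅ a : A, (d l₁ g₁ (φ l₁ a) + d l₂ (φ l₂ a) g₂))

/-- The maximum of a two-sided invariant metric and a rescaled pullback of another one along a
homomorphism is a two-sided invariant metric. -/
theorem IsTSIMetric.max_comap {G T : Type*} [Group G] [Group T] {d : G → G → ℝ} {e : T → T → ℝ}
    (hd : IsTSIMetric d) (he : IsTSIMetric e) (f : G →* T) {K : ℝ} (hK : 0 < K) :
    IsTSIMetric fun x y => max (d x y) (e (f x) (f y) / K) := by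
  obtain ⟨d_zero, d_symm, d_tri, d_left, d_right⟩ := hd
  obtain ⟨e_zero, e_symm, e_tri, e_left, e_right⟩ := he
  have d_nonneg : ∀ x y, 0 ≤ d x y := fun x y => by
    linarith [d_tri x y x, d_symm x y, (d_zero x x).2 rfl]
  refine ⟨fun x y => ⟨fun h => ?_, ?_⟩, fun x y => ?_, fun x y z => ?_, fun g x y => ?_,
    fun g x y => ?_⟩
  · exact (d_zero x y).1 (le_antisymm (h ▸ le_max_left _ _) (d_nonneg x y))
  · rintro rfl
    simp [(d_zero x x).2 rfl, (e_zero (f x) (f x)).2 rfl]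
  · simp only [d_symm x y, e_symm (f x) (f y)]
  · refine max_le ((d_tri x y z).trans (add_le_add (le_max_left _ _) (le_max_left _ _))) ?_
    calc e (f x) (f z) / K ≤ (e (f x) (f y) + e (f y) (f z)) / K := by
          gcongr
          exact e_tri _ _ _
      _ = e (f x) (f y) / K + e (f y) (f z) / K := add_div _ _ _
      _ ≤ _ := add_le_add (le_max_right _ _) (le_max_right _ _)
  · simp only [map_mul, d_left, e_left]
  · simp only [map_mul, d_right, e_right]

/-- The universal property of Graev metrics on amalgams: a family of `K`-Lipschitz homomorphisms
into a tsi group `T` agreeing on the amalgamated subgroup induces a `K`-Lipschitz homomorphism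
on the amalgam equipped with the Graev metric. -/
theorem graev_metric_lift_lipschitz {Λ : Type*} [Nonempty Λ] {G : Λ → Type*} [∀ l, Group (G l)]
    (d : ∀ l, G l → G l → ℝ) (hd : ∀ l, IsTSIMetric (d l))
    {A : Type*} [Group A] (φ : ∀ l, A →* G l)
    (hinj : ∀ l, Function.Injective (φ l))
    (hclosed : ∀ l, IsDClosed (d l) (Set.range (φ l)))
    (hagree : ∀ (l₁ l₂ : Λ) (a a' : A), d l₁ (φ l₁ a) (φ l₁ a') = d l₂ (φ l₂ a) (φ l₂ a'))
    (dbar : Monoid.PushoutI φ → Monoid.PushoutI φ → ℝ)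
    (hdbar : IsTSIMetric dbar) (hext : ExtendsAmalgamMetric φ d dbar)
    (hmax : ∀ δ : Monoid.PushoutI φ → Monoid.PushoutI φ → ℝ,
      IsTSIMetric δ → ExtendsAmalgamMetric φ d δ →
      ∀ x y : Monoid.PushoutI φ, δ x y ≤ dbar x y)
    {T : Type*} [Group T] (dT : T → T → ℝ) (hdT : IsTSIMetric dT)
    (K : ℝ) (hK : 0 < K) (ψl : ∀ l, G l →* T)
    (hLip : ∀ (l : Λ) (g h : G l), dT (ψl l g) (ψl l h) ≤ K * d l g h)
    (hcomp : ∀ (l₁ l₂ : Λ) (a : A), ψl l₁ (φ l₁ a) = ψl l₂ (φ l₂ a))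
    (ψ : Monoid.PushoutI φ →* T)
    (hψ : ∀ (l : Λ) (g : G l), ψ (Monoid.PushoutI.of (φ := φ) l g) = ψl l g) :
    ∀ x y : Monoid.PushoutI φ, dT (ψ x) (ψ y) ≤ K * dbar x y := by
  intro x y
  have hle := hmax _ (hdbar.max_comap hdT ψ hK) ⟨fun l g h => ?_, fun l₁ l₂ hne g₁ g₂ => ?_⟩ x y
  · exact (div_le_iff₀' hK).1 ((le_max_right _ _).trans hle)
  · beta_reduce
    rw [hext.1, hψ, hψ]
    exact max_eq_left ((div_le_iff₀' hK).2 (hLip l g h))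
  · beta_reduce
    rw [hext.2 l₁ l₂ hne, hψ, hψ]
    refine max_eq_left (le_ciInf fun a => (div_le_iff₀' hK).2 ?_)
    calc dT (ψl l₁ g₁) (ψl l₂ g₂)
        ≤ dT (ψl l₁ g₁) (ψl l₁ (φ l₁ a)) + dT (ψl l₁ (φ l₁ a)) (ψl l₂ g₂) := hdT.2.2.1 _ _ _
      _ ≤ K * d l₁ g₁ (φ l₁ a) + K * d l₂ (φ l₂ a) g₂ := by
          refine add_le_add (hLip _ _ _) ?_
          rw [hcomp l₁ l₂ a]
          exact hLip _ _ _
      _ = K * (d l₁ g₁ (φ l₁ a) + d l₂ (φ l₂ a) g₂) := (mul_add _ _ _).symm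
end
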